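/- arXiv:1602.08925 — 2 statements merged into one kernel-verified Lean document; each statement's English description precedes it below -/
import Mathlib

section
/- Let π be an optimization problem on graphs such that (a) adm_π ∈ Λ_1 ∩ co-Λ_1, and (b) the objective value of a configuration is the sum over all nodes of an individual integer value at each node that is computable from a constant-radius ball around the node and is bounded in absolute value by n^γ for a fixed constant γ. Then opt_π ∈ co-Λ_1. -/
/-!
Distributed decision in the LOCAL model: configurations, local algorithms,
the local hierarchy Σ_k / Π_k / Λ_k and co-Λ_k.
-/

/-- A configuration: a finite connected simple graph on `Fin n` (with `n ≥ 1`)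
together with an input bit string at each node. -/
structure Config where
  n : ℕ
  npos : 0 < n
  G : SimpleGraph (Fin n)
  conn : G.Connected
  x : Fin n → List Bool

/-- The ball of radius `t` around `v`: all nodes at distance at most `t`. -/
def ball (C : Config) (v : Fin C.n) (t : ℕ) : Set (Fin C.n) :=
  {u | C.G.dist v u ≤ t}

lemma self_mem_ball (C : Config) (v : Fin C.n) (t : ℕ) : v ∈ ball C v t := by
  simp [ball, SimpleGraph.dist_self]

/-- A `t`-round local algorithm: at each node it outputs a bit, computed from the whole
configuration, identity assignment and labellings, subject to locality: the output at `v`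
only depends on the ball of radius `t` around `v` together with the inputs, identities and
labellings on it (isomorphic labelled balls give equal outputs). -/
structure LocalAlg where
  t : ℕ
  run : (C : Config) → (Fin C.n → ℕ) → (ℕ → Fin C.n → List Bool) → Fin C.n → Bool
  isLocal : ∀ (C C' : Config) (ident : Fin C.n → ℕ) (ident' : Fin C'.n → ℕ)
      (ℓ : ℕ → Fin C.n → List Bool) (ℓ' : ℕ → Fin C'.n → List Bool)
      (v : Fin C.n) (v' : Fin C'.n)
      (φ : (C.G.induce (ball C v t)) ≃g (C'.G.induce (ball C' v' t))),
      ((φ ⟨v, self_mem_ball C v t⟩).val = v') →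
      (∀ u : ball C v t, C'.x (φ u).val = C.x u.val) →
      (∀ u : ball C v t, ident' (φ u).val = ident u.val) →
      (∀ (i : ℕ) (u : ball C v t), ℓ' i (φ u).val = ℓ i u.val) →
      run C ident ℓ v = run C' ident' ℓ' v'

/-- A labelling of size `c · log₂ n`. -/
def goodLabel (c : ℕ) (C : Config) (ℓ : Fin C.n → List Bool) : Prop :=
  ∀ v, (ℓ v).length ≤ c * Nat.log 2 C.n

/-- Alternating quantification over `j` further labellings (stored at indices `i, i+1, …`),
starting with an existential quantifier when the `Bool` argument is `true` and with a
universal quantifier when it is `false`; `P` is the final predicate. -/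
def altQ (c : ℕ) (C : Config) (P : (ℕ → Fin C.n → List Bool) → Prop) :
    ℕ → ℕ → Bool → (ℕ → Fin C.n → List Bool) → Prop
  | 0, _, _, ℓs => P ℓs
  | j + 1, i, true, ℓs =>
      ∃ ℓ, goodLabel c C ℓ ∧ altQ c C P j (i + 1) false (Function.update ℓs i ℓ)
  | j + 1, i, false, ℓs =>
      ∀ ℓ, goodLabel c C ℓ → altQ c C P j (i + 1) true (Function.update ℓs i ℓ)

/-- Global acceptance: every node outputs 1. -/
def accepts (A : LocalAlg) (C : Config) (ident : Fin C.n → ℕ)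
    (ℓs : ℕ → Fin C.n → List Bool) : Prop :=
  ∀ v, A.run C ident ℓs v = true

/-- The empty collection of labellings. -/
def noLabels (C : Config) : ℕ → Fin C.n → List Bool := fun _ _ => []

/-- Inputs are bounded by `α · log₂ n` bits. -/
def BoundedInput (α : ℕ) (C : Config) : Prop :=
  ∀ v, (C.x v).length ≤ α * Nat.log 2 C.n

/-- An identity assignment: injective, with values in `{1, …, n^β}`. -/
def IsIdAssignment (β : ℕ) (C : Config) (ident : Fin C.n → ℕ) : Prop :=
  Function.Injective ident ∧ ∀ v, 1 ≤ ident v ∧ ident v ≤ C.n ^ β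

/-- The class `Σ_k` (with input-size constant `α` and identity-space constant `β`):
`(G,x) ∈ L ⟺ ∃ℓ₁ ∀ℓ₂ … Q ℓ_k`, `A` accepts, for every identity assignment. -/
def SigmaC (α β k : ℕ) (L : Set Config) : Prop :=
  ∃ (A : LocalAlg) (c : ℕ), ∀ C : Config, BoundedInput α C →
    ∀ ident : Fin C.n → ℕ, IsIdAssignment β C ident →
      (C ∈ L ↔ altQ c C (accepts A C ident) k 0 true (noLabels C))

/-- The class `Π_k`: as `Σ_k` but the alternation starts with a universal quantifier. -/
def PiC (α β k : ℕ) (L : Set Config) : Prop :=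
  ∃ (A : LocalAlg) (c : ℕ), ∀ C : Config, BoundedInput α C →
    ∀ ident : Fin C.n → ℕ, IsIdAssignment β C ident →
      (C ∈ L ↔ altQ c C (accepts A C ident) k 0 false (noLabels C))

/-- `Λ_k := Σ_k` for odd `k`, `Λ_k := Π_k` for even `k` (so `Λ_0 = LD`). -/
def LambdaC (α β k : ℕ) (L : Set Config) : Prop :=
  if k % 2 = 1 then SigmaC α β k L else PiC α β k L

/-- `co-Λ_k`: the complement (within the set of all configurations) is in `Λ_k`. -/
def coLambdaC (α β k : ℕ) (L : Set Config) : Prop :=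
  LambdaC α β k ({C : Config | BoundedInput α C} \ L)

/-- Input-preserving isomorphism of configurations. -/
def ConfigIso (C C' : Config) : Prop :=
  ∃ φ : C.G ≃g C'.G, ∀ v, C'.x (φ v) = C.x v

/-- A distributed language: a set of configurations (with bounded inputs)
closed under input-preserving isomorphism. -/
def IsDistLang (α : ℕ) (L : Set Config) : Prop :=
  (∀ C ∈ L, BoundedInput α C) ∧ ∀ C C', ConfigIso C C' → (C ∈ L ↔ C' ∈ L)

/-- The leading quantifier of `Λ_k`: existential iff `k` is odd. -/
def startEx (k : ℕ) : Bool := decide (k % 2 = 1)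

/-- An optimization problem on graphs: a distributed language `adm` of admissible
configurations, an objective direction, and an individual integer value `w` at each node,
bounded by `n^γ` in absolute value and computable from a ball of fixed radius `r` around
the node together with the inputs on it. -/
structure OptProblem where
  adm : Set Config
  maximize : Bool
  γ : ℕ
  w : (C : Config) → Fin C.n → ℤ
  w_bound : ∀ (C : Config) (v : Fin C.n), |w C v| ≤ (C.n : ℤ) ^ γ
  r : ℕ
  w_local : ∀ (C C' : Config) (v : Fin C.n) (v' : Fin C'.n)
      (φ : (C.G.induce (ball C v r)) ≃g (C'.G.induce (ball C' v' r))),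
      ((φ ⟨v, self_mem_ball C v r⟩).val = v') →
      (∀ u : ball C v r, C'.x (φ u).val = C.x u.val) →
      w C v = w C' v'

/-- The objective value: the sum over all nodes of the individual values. -/
def objVal (π : OptProblem) (C : Config) : ℤ := ∑ v, π.w C v

/-- The configuration obtained from `C` by replacing its input by `x'` (same graph). -/
def sameGraphCfg (C : Config) (x' : Fin C.n → List Bool) : Config :=
  ⟨C.n, C.npos, C.G, C.conn, x'⟩

/-- `opt_π`: admissible configurations whose objective value is optimal among all
admissible inputs on the same graph. -/
def optSet (α : ℕ) (π : OptProblem) : Set Config :=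
  {C | C ∈ π.adm ∧ ∀ x' : Fin C.n → List Bool,
    BoundedInput α (sameGraphCfg C x') → sameGraphCfg C x' ∈ π.adm →
      (if π.maximize then objVal π (sameGraphCfg C x') ≤ objVal π C
       else objVal π C ≤ objVal π (sameGraphCfg C x'))}

/-- Read one self-delimited field off the front of a bit string. -/
def readField : List Bool → List Bool × List Bool
  | true :: b :: l => (b :: (readField l).1, (readField l).2)
  | false :: l => ([], l)
  | _ => ([], [])

/-- The self-delimiting code of a bit string. -/
def writeField : List Bool → List Bool
  | [] => [false]
  | b :: l => true :: b :: writeField l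

lemma readField_writeField_append (a r : List Bool) :
    readField (writeField a ++ r) = (a, r) := by
  induction a with
  | nil => simp [writeField, readField]
  | cons b l ih => simp [writeField, readField, ih]

lemma length_writeField (a : List Bool) : (writeField a).length = 2 * a.length + 1 := by
  induction a with
  | nil => simp [writeField]
  | cons b l ih => simp [writeField, ih]; ring

/-- The `i`-th field stored in a bit string. -/
def field : ℕ → List Bool → List Bool
  | 0, l => (readField l).1
  | i + 1, l => field i (readField l).2

lemma exists_field_eq (B : ℕ) (fs : List (List Bool)) (hfs : ∀ f ∈ fs, f.length ≤ B) :
    ∃ l : List Bool, l.length ≤ fs.length * (2 * B + 1) ∧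
      ∀ r i, ∀ h : i < fs.length, field i (l ++ r) = fs[i] := by
  induction fs with
  | nil => exact ⟨[], by simp⟩
  | cons f fs ih =>
    obtain ⟨l, hl, hf⟩ := ih fun g hg => hfs g (List.mem_cons_of_mem _ hg)
    refine ⟨writeField f ++ l, ?_, ?_⟩
    · have := hfs f List.mem_cons_self
      simp only [List.length_append, length_writeField, List.length_cons]
      nlinarith
    · rintro r (_ | i) h
      · simp [field, readField_writeField_append]
      · simpa [field, readField_writeField_append] using hf r i (by simpa using h)

/-- Padding the stored fields to a prescribed length. -/
lemma exists_field_eq_of_length (a k : ℕ) (hk : 1 ≤ k) (fs : List (List Bool))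
    (hfs : ∀ f ∈ fs, f.length ≤ a * k) :
    ∃ l : List Bool, l.length = fs.length * (2 * a + 1) * k ∧
      ∀ i, ∀ h : i < fs.length, field i l = fs[i] := by
  obtain ⟨l, hl, hf⟩ := exists_field_eq (a * k) fs hfs
  have hle : l.length ≤ fs.length * (2 * a + 1) * k := by
    refine hl.trans ?_
    rw [mul_assoc]
    gcongr
    nlinarith
  refine ⟨l ++ List.replicate (fs.length * (2 * a + 1) * k - l.length) false, ?_, hf _⟩
  simp; omega

/-- The natural number with the given binary digits, least significant first. -/
def bitsToNat (l : List Bool) : ℕ := l.foldr Nat.bit 0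

lemma bitsToNat_bits (m : ℕ) : bitsToNat m.bits = m := by
  induction m using Nat.binaryRec' with
  | zero => simp [bitsToNat]
  | bit b n h ih =>
    rw [Nat.bits_append_bit n b h]
    simp only [bitsToNat, List.foldr_cons] at ih ⊢
    rw [ih]

lemma length_bits_le {m j : ℕ} (h : m < 2 ^ j) : m.bits.length ≤ j := by
  rw [Nat.size_eq_bits_len]
  exact Nat.size_le.2 h

/-- The depth stored in a label. -/
def labelDepth (l : List Bool) : ℕ := bitsToNat (field 3 l)

/-- The identity of the parent stored in a label. -/
def labelParent (l : List Bool) : ℕ := bitsToNat (field 4 l)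

/-- The partial sum stored in a label. -/
def labelSum (l : List Bool) : ℤ := bitsToNat (field 5 l) - bitsToNat (field 6 l)

section Tree

variable {V : Type*} [Fintype V]

lemma sum_roots_eq (d : V → ℕ) (par : V → V) (f s : V → ℤ)
    (hs : ∀ v, s v = f v + ∑ u, open Classical in if d u ≠ 0 ∧ par u = v then s u else 0) :
    ∑ v, (if d v = 0 then s v else 0) = ∑ v, f v := by
  classical
  have h1 : ∑ v, s v = ∑ v, f v + ∑ u, if d u ≠ 0 then s u else 0 := by
    conv_lhs => rw [Finset.sum_congr rfl fun v _ => hs v]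
    rw [Finset.sum_add_distrib, Finset.sum_comm]
    congr 1
    refine Finset.sum_congr rfl fun u _ => ?_
    by_cases hu : d u = 0 <;> simp [hu]
  have h2 : ∑ v, s v = ∑ v, (if d v = 0 then s v else 0) + ∑ v, if d v ≠ 0 then s v else 0 := by
    rw [← Finset.sum_add_distrib]
    refine Finset.sum_congr rfl fun u _ => ?_
    by_cases hu : d u = 0 <;> simp [hu]
  linarith

lemma exists_subtree_sums (d : V → ℕ) (par : V → V)
    (hd : ∀ v, d v ≠ 0 → d (par v) + 1 = d v) (f : V → ℤ) :
    ∃ s : V → ℤ,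
      (∀ v, s v = f v + ∑ u, open Classical in if d u ≠ 0 ∧ par u = v then s u else 0) ∧
      ∀ v, |s v| ≤ ∑ u, (d u + 1 : ℤ) * |f u| := by
  classical
  let g : V → V → ℤ := fun u v => ∑ j ∈ Finset.range (d u + 1), if par^[j] u = v then 1 else 0
  have g0 : ∀ u v, d u = 0 → g u v = if u = v then 1 else 0 := by
    intro u v h
    simp only [g, h, zero_add, Finset.sum_range_one, Function.iterate_zero, id_eq]
    congr
  have g1 : ∀ u v, d u ≠ 0 → g u v = (if u = v then 1 else 0) + g (par u) v := by
    intro u v h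
    simp only [g]
    rw [Finset.sum_range_succ', hd u h, add_comm]
    simp only [Function.iterate_zero, id_eq, Function.iterate_succ_apply]
    congr
  have key : ∀ m u, d u = m → ∀ v,
      g u v = (if u = v then 1 else 0) + ∑ c, if d c ≠ 0 ∧ par c = v then g u c else 0 := by
    intro m
    induction m with
    | zero =>
      intro u hu v
      rw [g0 u v hu, Finset.sum_eq_zero, add_zero]
      intro c _
      split_ifs with hc
      · rw [g0 u c hu, if_neg]
        rintro rfl
        exact hc.1 hu
      · rfl
    | succ m ih =>
      intro u hu v
      have hu0 : d u ≠ 0 := by omega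
      have hp := ih (par u) (by have := hd u hu0; omega) v
      rw [g1 u v hu0, hp]
      congr 1
      have : ∀ c, (if d c ≠ 0 ∧ par c = v then g u c else 0) =
          (if u = c then (if par u = v then (1 : ℤ) else 0) else 0) +
            if d c ≠ 0 ∧ par c = v then g (par u) c else 0 := by
        intro c
        rw [g1 u c hu0]
        by_cases huc : u = c
        · subst huc
          by_cases hv : par u = v <;> simp [hu0, hv]
        · simp [huc]
      rw [Finset.sum_congr rfl fun c _ => this c, Finset.sum_add_distrib]
      simp
  refine ⟨fun v => ∑ u, g u v * f u, fun v => ?_, fun v => ?_⟩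
  · have h : ∀ u, g u v * f u = (if u = v then f u else 0) +
        ∑ c, if d c ≠ 0 ∧ par c = v then g u c * f u else 0 := by
      intro u
      rw [key _ u rfl v, add_mul, Finset.sum_mul]
      congr 1
      · simp
      · exact Finset.sum_congr rfl fun c _ => by simp
    simp only []
    rw [Finset.sum_congr rfl fun u _ => h u, Finset.sum_add_distrib, Finset.sum_comm]
    congr 1
    · simp
    · refine Finset.sum_congr rfl fun c _ => ?_
      split_ifs <;> simp
  · refine (Finset.abs_sum_le_sum_abs _ _).trans (Finset.sum_le_sum fun u _ => ?_)
    rw [abs_mul]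
    refine mul_le_mul_of_nonneg_right ?_ (abs_nonneg _)
    refine (Finset.abs_sum_le_sum_abs _ _).trans ?_
    calc _ ≤ ∑ j ∈ Finset.range (d u + 1), (1 : ℤ) :=
          Finset.sum_le_sum fun j _ => by split_ifs <;> simp
      _ = _ := by simp

open Classical in
/-- The local check, at node `b`, that the labels describe a rooted forest with correct partial
sums of `f` which are positive at the roots. -/
def TreeCheck (H : SimpleGraph V) (b : V) (ident : V → ℕ) (L : V → List Bool) (f : ℤ) : Prop :=
  (labelDepth (L b) = 0 → 0 < labelSum (L b)) ∧
  (labelDepth (L b) ≠ 0 → ∃ u, H.Adj u b ∧ ident u = labelParent (L b) ∧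
    labelDepth (L u) + 1 = labelDepth (L b)) ∧
  labelSum (L b) = f + ∑ u, if H.Adj u b ∧ labelDepth (L u) ≠ 0 ∧ labelParent (L u) = ident b
    then labelSum (L u) else 0

lemma treeCheck_iso {W : Type*} [Fintype W] {H : SimpleGraph V} {K : SimpleGraph W}
    (φ : H ≃g K) (b : V) (ident : W → ℕ) (L : W → List Bool) (f : ℤ) :
    TreeCheck H b (ident ∘ φ) (L ∘ φ) f ↔ TreeCheck K (φ b) ident L f := by
  classical
  unfold TreeCheck
  rw [← φ.toEquiv.exists_congr_right, ← φ.toEquiv.sum_comp]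
  simp [φ.map_adj_iff]

lemma treeCheck_induce (H : SimpleGraph V) (B : Set V) [Fintype B] (b : V) (hb : b ∈ B)
    (hB : ∀ u, H.Adj u b → u ∈ B) (ident : V → ℕ) (L : V → List Bool) (f : ℤ) :
    TreeCheck (H.induce B) ⟨b, hb⟩ (fun u => ident u) (fun u => L u) f ↔
      TreeCheck H b ident L f := by
  classical
  unfold TreeCheck
  refine and_congr Iff.rfl (and_congr (imp_congr Iff.rfl ?_) ?_)
  · simp only [Subtype.exists, SimpleGraph.comap_adj, Function.Embedding.subtype_apply]
    exact ⟨fun ⟨u, _, h⟩ => ⟨u, h⟩, fun ⟨u, h⟩ => ⟨u, hB u h.1, h⟩⟩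
  · have : ∑ u : B, (if (H.induce B).Adj u ⟨b, hb⟩ ∧ labelDepth (L u) ≠ 0 ∧
        labelParent (L u) = ident b then labelSum (L u) else 0) =
        ∑ u, if H.Adj u b ∧ labelDepth (L u) ≠ 0 ∧ labelParent (L u) = ident b
          then labelSum (L u) else 0 := by
      rw [← Finset.sum_subset (Finset.subset_univ (Finset.univ.filter (· ∈ B)))]
      · rw [Finset.sum_subtype (p := (· ∈ B)) _ (by simp)]
        exact Finset.sum_congr (by congr) fun u _ => by simp
      · intro u _ hu
        rw [if_neg]
        rintro ⟨h, -⟩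
        exact hu (by simpa using hB u h)
    simp only at this ⊢
    rw [this]

lemma sum_pos_of_treeCheck [Nonempty V] (H : SimpleGraph V) (ident : V → ℕ)
    (hid : Function.Injective ident) (L : V → List Bool) (f : V → ℤ)
    (h : ∀ v, TreeCheck H v ident L (f v)) : 0 < ∑ v, f v := by
  classical
  have hpar : ∀ v, ∃ u, labelDepth (L v) ≠ 0 → H.Adj u v ∧ ident u = labelParent (L v) ∧
      labelDepth (L u) + 1 = labelDepth (L v) := by
    intro v
    by_cases hv : labelDepth (L v) = 0
    · exact ⟨v, fun h => absurd hv h⟩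
    · obtain ⟨u, hu⟩ := (h v).2.1 hv
      exact ⟨u, fun _ => hu⟩
  choose par hpar using hpar
  rw [← sum_roots_eq (fun v => labelDepth (L v)) par f (fun v => labelSum (L v))]
  · obtain ⟨r, hr⟩ := Finite.exists_min fun v => labelDepth (L v)
    have hr0 : labelDepth (L r) = 0 := by
      by_contra h0
      have := (hpar r h0).2.2
      have := hr (par r)
      omega
    refine Finset.sum_pos' (fun v _ => ?_) ⟨r, Finset.mem_univ _, ?_⟩
    · split_ifs with hv
      · exact ((h v).1 hv).le
      · rfl
    · simpa [hr0] using (h r).1 hr0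
  · intro v
    rw [(h v).2.2]
    congr 1
    refine Finset.sum_congr rfl fun u _ => if_congr ?_ rfl rfl
    constructor
    · rintro ⟨_, h0, hp⟩
      exact ⟨h0, hid ((hpar u h0).2.1.trans hp)⟩
    · rintro ⟨h0, rfl⟩
      exact ⟨(hpar u h0).1.symm, h0, (hpar u h0).2.1.symm⟩

end Tree

lemma SimpleGraph.Connected.exists_adj_dist_add_one {V : Type*} {G : SimpleGraph V}
    (hG : G.Connected) {r v : V} (h : G.dist r v ≠ 0) :
    ∃ u, G.Adj u v ∧ G.dist r u + 1 = G.dist r v := by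
  obtain ⟨p, hp⟩ := hG.exists_walk_length_eq_dist v r
  rw [SimpleGraph.dist_comm] at hp
  cases p with
  | nil => simp at h
  | @cons _ u _ ha q =>
    refine ⟨u, ha.symm, ?_⟩
    have h1 := SimpleGraph.dist_le q
    have h2 := hG.dist_triangle (u := r) (v := u) (w := v)
    have h3 : G.dist u v = 1 := SimpleGraph.dist_eq_one_iff_adj.2 ha.symm
    rw [SimpleGraph.dist_comm] at h1
    simp at hp
    omega

lemma dist_ballIso_le {C C' : Config} {T : ℕ} {v : Fin C.n} {v' : Fin C'.n}
    (φ : (C.G.induce (ball C v T)) ≃g (C'.G.induce (ball C' v' T)))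
    (hφ : (φ ⟨v, self_mem_ball C v T⟩).val = v') (u : ball C v T) :
    C'.G.dist v' (φ u).val ≤ C.G.dist v u.val := by
  obtain ⟨m, hm⟩ : ∃ m, C.G.dist v u.val = m := ⟨_, rfl⟩
  induction m generalizing u with
  | zero =>
    have : u = ⟨v, self_mem_ball C v T⟩ := Subtype.ext (C.conn.dist_eq_zero_iff.1 hm).symm
    rw [this, hφ]
    simp
  | succ m ih =>
    obtain ⟨w, hw, hwd⟩ := C.conn.exists_adj_dist_add_one (r := v) (v := u.val) (by omega)
    have hwT : w ∈ ball C v T := by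
      have := u.2
      simp only [ball, Set.mem_ofPred_eq] at this ⊢
      omega
    have h1 := ih ⟨w, hwT⟩ (by simp; omega)
    have h2 : (C'.G.induce (ball C' v' T)).Adj (φ ⟨w, hwT⟩) (φ u) :=
      φ.map_adj_iff.2 (by simpa using hw)
    have h3 : C'.G.dist (φ ⟨w, hwT⟩).val (φ u).val = 1 :=
      SimpleGraph.dist_eq_one_iff_adj.2 (by simpa using h2)
    have h4 := C'.conn.dist_triangle (u := v') (v := (φ ⟨w, hwT⟩).val) (w := (φ u).val)
    simp only at h1
    omega

/-- An isomorphism of balls preserving the centre restricts to smaller balls. -/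
lemma exists_ballIso_of_le {C C' : Config} {t T : ℕ} (htT : t ≤ T) {v : Fin C.n} {v' : Fin C'.n}
    (φ : (C.G.induce (ball C v T)) ≃g (C'.G.induce (ball C' v' T)))
    (hφ : (φ ⟨v, self_mem_ball C v T⟩).val = v') :
    ∃ ψ : (C.G.induce (ball C v t)) ≃g (C'.G.induce (ball C' v' t)),
      (ψ ⟨v, self_mem_ball C v t⟩).val = v' ∧
      ∀ u : ball C v t, ∃ u' : ball C v T, u'.val = u.val ∧ (ψ u).val = (φ u').val := by
  have hsymm : (φ.symm ⟨v', self_mem_ball C' v' T⟩).val = v := by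
    have : φ.symm ⟨v', self_mem_ball C' v' T⟩ = ⟨v, self_mem_ball C v T⟩ := by
      rw [RelIso.symm_apply_eq]
      exact Subtype.ext hφ.symm
    rw [this]
  have hsub : ∀ {D : Config} {w : Fin D.n}, ball D w t ⊆ ball D w T :=
    fun {D w} u hu => le_trans (show D.G.dist w u ≤ t from hu) htT
  let ψ : (C.G.induce (ball C v t)) ≃g (C'.G.induce (ball C' v' t)) :=
    { toFun := fun u => ⟨(φ ⟨u.1, hsub u.2⟩).1, (dist_ballIso_le φ hφ _).trans u.2⟩
      invFun := fun u => ⟨(φ.symm ⟨u.1, hsub u.2⟩).1,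
        (dist_ballIso_le φ.symm hsymm _).trans u.2⟩
      left_inv := fun u => by simp
      right_inv := fun u => by simp
      map_rel_iff' := fun {a b} => by
        have := φ.map_adj_iff (v := ⟨a.1, hsub a.2⟩) (w := ⟨b.1, hsub b.2⟩)
        simpa using this }
  exact ⟨ψ, hφ, fun u => ⟨⟨u.1, hsub u.2⟩, rfl, rfl⟩⟩

/-- The single labelling `ℓ` as a tuple of labellings. -/
def oneLabel (C : Config) (ℓ : Fin C.n → List Bool) : ℕ → Fin C.n → List Bool :=
  Function.update (noLabels C) 0 ℓ

/-- The input stored in the labels. -/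
def storedInput (C : Config) (ℓ : Fin C.n → List Bool) : Config :=
  sameGraphCfg C fun u => field 1 (ℓ u)

/-- The gain at `v` of the input `x'` over that of `C`, according to the direction of `π`. -/
def gain (π : OptProblem) (C : Config) (x' : Fin C.n → List Bool) (v : Fin C.n) : ℤ :=
  if π.maximize then π.w (sameGraphCfg C x') v - π.w C v
  else π.w C v - π.w (sameGraphCfg C x') v

lemma LocalAlg.run_congr_ball (A : LocalAlg) {C C' : Config} {T : ℕ} (hT : A.t ≤ T)
    {ident : Fin C.n → ℕ} {ident' : Fin C'.n → ℕ}
    {ℓ : Fin C.n → List Bool} {ℓ' : Fin C'.n → List Bool}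
    {v : Fin C.n} {v' : Fin C'.n}
    (φ : (C.G.induce (ball C v T)) ≃g (C'.G.induce (ball C' v' T)))
    (hφ : (φ ⟨v, self_mem_ball C v T⟩).val = v')
    (hx : ∀ u : ball C v T, C'.x (φ u).val = C.x u.val)
    (hid : ∀ u : ball C v T, ident' (φ u).val = ident u.val)
    (hℓ : ∀ u : ball C v T, ℓ' (φ u).val = ℓ u.val) :
    A.run C ident (oneLabel C ℓ) v = A.run C' ident' (oneLabel C' ℓ') v' := by
  obtain ⟨ψ, hψ, h⟩ := exists_ballIso_of_le hT φ hφ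
  refine A.isLocal C C' ident ident' _ _ v v' ψ hψ (fun u => ?_) (fun u => ?_) (fun i u => ?_)
  · obtain ⟨u', h1, h2⟩ := h u
    rw [h2, hx, h1]
  · obtain ⟨u', h1, h2⟩ := h u
    rw [h2, hid, h1]
  · obtain ⟨u', h1, h2⟩ := h u
    rcases i with _ | i
    · simp [oneLabel, h2, hℓ, h1]
    · simp [oneLabel, noLabels]

lemma OptProblem.w_congr_ball (π : OptProblem) {C C' : Config} {T : ℕ} (hT : π.r ≤ T)
    {v : Fin C.n} {v' : Fin C'.n}
    (φ : (C.G.induce (ball C v T)) ≃g (C'.G.induce (ball C' v' T)))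
    (hφ : (φ ⟨v, self_mem_ball C v T⟩).val = v')
    (hx : ∀ u : ball C v T, C'.x (φ u).val = C.x u.val) : π.w C v = π.w C' v' := by
  obtain ⟨ψ, hψ, h⟩ := exists_ballIso_of_le hT φ hφ
  refine π.w_local C C' v v' ψ hψ fun u => ?_
  obtain ⟨u', h1, h2⟩ := h u
  rw [h2, hx, h1]

open Classical in
/-- The condition verified at node `v` by the verifier of non-optimality. Labels carry: a flag
(field 0), an alternative input (field 1), a certificate for `A₁` or `A₂` (field 2), and a rooted
tree with partial sums (fields 3 to 6). Label lengths bound `log₂ n` from below. -/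
def NonOptCheck (α c c₁ c₂ T : ℕ) (A₁ A₂ : LocalAlg) (π : OptProblem) (C : Config)
    (ident : Fin C.n → ℕ) (ℓ : Fin C.n → List Bool) (v : Fin C.n) : Prop :=
  (∀ u : ball C v T, (C.G.induce (ball C v T)).Adj ⟨v, self_mem_ball C v T⟩ u →
    (field 0 (ℓ u) = [] ↔ field 0 (ℓ v) = [])) ∧
  (field 0 (ℓ v) = [] → (field 2 (ℓ v)).length ≤ c₂ * ((ℓ v).length / c) ∧
    A₂.run C ident (oneLabel C fun u => field 2 (ℓ u)) v = true) ∧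
  (field 0 (ℓ v) ≠ [] → (field 1 (ℓ v)).length ≤ α * ((ℓ v).length / c) ∧
    (field 2 (ℓ v)).length ≤ c₁ * ((ℓ v).length / c) ∧
    A₁.run (storedInput C ℓ) ident (oneLabel C fun u => field 2 (ℓ u)) v = true ∧
    TreeCheck (C.G.induce (ball C v T)) ⟨v, self_mem_ball C v T⟩ (fun u => ident u)
      (fun u => ℓ u) (gain π C (fun u => field 1 (ℓ u)) v))

lemma nonOptCheck_congr {α c c₁ c₂ T : ℕ} {A₁ A₂ : LocalAlg} {π : OptProblem}
    (h₁ : A₁.t ≤ T) (h₂ : A₂.t ≤ T) (hr : π.r ≤ T) {C C' : Config}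
    {ident : Fin C.n → ℕ} {ident' : Fin C'.n → ℕ}
    {ℓ : Fin C.n → List Bool} {ℓ' : Fin C'.n → List Bool}
    {v : Fin C.n} {v' : Fin C'.n}
    (φ : (C.G.induce (ball C v T)) ≃g (C'.G.induce (ball C' v' T)))
    (hφ : (φ ⟨v, self_mem_ball C v T⟩).val = v')
    (hx : ∀ u : ball C v T, C'.x (φ u).val = C.x u.val)
    (hid : ∀ u : ball C v T, ident' (φ u).val = ident u.val)
    (hℓ : ∀ u : ball C v T, ℓ' (φ u).val = ℓ u.val) :
    NonOptCheck α c c₁ c₂ T A₁ A₂ π C ident ℓ v ↔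
      NonOptCheck α c c₁ c₂ T A₁ A₂ π C' ident' ℓ' v' := by
  classical
  have hc : φ ⟨v, self_mem_ball C v T⟩ = ⟨v', self_mem_ball C' v' T⟩ := Subtype.ext hφ
  have hv : ℓ' v' = ℓ v := by rw [← hφ]; exact hℓ _
  have hf : ∀ i, ∀ u : ball C v T, field i (ℓ' (φ u).val) = field i (ℓ u.val) :=
    fun i u => by rw [hℓ]
  have hA₂ := A₂.run_congr_ball (ℓ := fun u => field 2 (ℓ u)) (ℓ' := fun u => field 2 (ℓ' u))
    h₂ φ hφ hx hid (hf 2)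
  have hA₁ := A₁.run_congr_ball (C := storedInput C ℓ) (C' := storedInput C' ℓ')
    (ℓ := fun u => field 2 (ℓ u)) (ℓ' := fun u => field 2 (ℓ' u))
    h₁ φ hφ (hf 1) hid (hf 2)
  have hw := π.w_congr_ball hr φ hφ hx
  have hw' := π.w_congr_ball (C := storedInput C ℓ) (C' := storedInput C' ℓ') hr φ hφ (hf 1)
  have hg : gain π C (fun u => field 1 (ℓ u)) v = gain π C' (fun u => field 1 (ℓ' u)) v' := by
    unfold gain
    unfold storedInput at hw'
    rw [hw, hw']
  have htree := treeCheck_iso φ ⟨v, self_mem_ball C v T⟩ (fun u => ident' u) (fun u => ℓ' u)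
    (gain π C' (fun u => field 1 (ℓ' u)) v')
  have e1 : (fun u : ball C' v' T => ident' u) ∘ φ = fun u => ident u.val := funext hid
  have e2 : (fun u : ball C' v' T => ℓ' u) ∘ φ = fun u => ℓ u.val := funext hℓ
  rw [e1, e2, hc] at htree
  unfold NonOptCheck
  rw [hv, hg, htree, hA₂]
  refine and_congr ?_ (and_congr Iff.rfl (imp_congr Iff.rfl
    (and_congr Iff.rfl (and_congr Iff.rfl (and_congr ?_ Iff.rfl)))))
  · rw [← φ.toEquiv.forall_congr_right]
    refine forall_congr' fun u => ?_
    rw [← hc]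
    simp only [RelIso.coe_fn_toEquiv, φ.map_adj_iff, hℓ]
  · exact Eq.congr hA₁ rfl

open Classical in
/-- The verifier of non-optimality; on one-node graphs it outputs the constant `b`. -/
noncomputable def nonOptAlg (α c c₁ c₂ : ℕ) (A₁ A₂ : LocalAlg) (π : OptProblem) (b : Bool) :
    LocalAlg where
  t := A₁.t + A₂.t + π.r + 1
  run C ident ℓ v :=
    if Subsingleton (ball C v (A₁.t + A₂.t + π.r + 1)) then b
    else decide (NonOptCheck α c c₁ c₂ (A₁.t + A₂.t + π.r + 1) A₁ A₂ π C ident (ℓ 0) v)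
  isLocal C C' ident ident' ℓ ℓ' v v' φ hφ hx hid hℓ := by
    refine if_congr φ.toEquiv.subsingleton_congr rfl ?_
    rw [decide_eq_decide]
    exact nonOptCheck_congr (by omega) (by omega) (by omega) φ hφ hx hid (hℓ 0)

lemma mem_ball_of_adj {C : Config} {u v : Fin C.n} {T : ℕ} (hT : 1 ≤ T) (h : C.G.Adj u v) :
    u ∈ ball C v T := by
  simp only [ball, Set.mem_ofPred_eq]
  rwa [SimpleGraph.dist_eq_one_iff_adj.2 h.symm]

lemma subsingleton_ball_iff (C : Config) (v : Fin C.n) {T : ℕ} (hT : 1 ≤ T) :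
    Subsingleton (ball C v T) ↔ C.n = 1 := by
  constructor
  · intro h
    by_contra hn
    have : Nontrivial (Fin C.n) := Fin.nontrivial_iff_two_le.2 (by have := C.npos; omega)
    obtain ⟨u, hu⟩ := C.conn.preconnected.exists_adj_of_nontrivial v
    have := congrArg Subtype.val (h.elim ⟨v, self_mem_ball C v T⟩ ⟨u, mem_ball_of_adj hT hu.symm⟩)
    exact hu.ne this
  · intro h
    have : Subsingleton (Fin C.n) := by rw [h]; infer_instance
    infer_instance

lemma eq_of_n_eq_one {α : ℕ} {C C' : Config} (hC : BoundedInput α C) (hC' : BoundedInput α C')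
    (h : C.n = 1) (h' : C'.n = 1) : C = C' := by
  obtain ⟨n, hn, G, hG, x⟩ := C
  obtain ⟨n', hn', G', hG', x'⟩ := C'
  simp only at h h'
  subst h h'
  have hx : x = x' := by
    funext v
    have h1 := hC v
    have h2 := hC' v
    simp at h1 h2
    rw [h1, h2]
  have hG : G = G' := Subsingleton.elim _ _
  subst hx hG
  rfl

lemma forall_iff_of_connected {V : Type*} {G : SimpleGraph V} (hG : G.Connected) {p : V → Prop}
    (h : ∀ v u, G.Adj v u → (p u ↔ p v)) (v u : V) : p u ↔ p v := by
  obtain ⟨w⟩ := hG.preconnected v u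
  induction w with
  | nil => rfl
  | cons ha _ ih => exact ih.trans (h _ _ ha)

lemma lambdaC_one_iff {α β : ℕ} {L : Set Config} :
    LambdaC α β 1 L ↔ ∃ (A : LocalAlg) (c : ℕ), ∀ C : Config, BoundedInput α C →
      ∀ ident : Fin C.n → ℕ, IsIdAssignment β C ident →
        (C ∈ L ↔ ∃ ℓ, goodLabel c C ℓ ∧ accepts A C ident (oneLabel C ℓ)) := by
  simp [LambdaC, SigmaC, altQ, oneLabel]

lemma sum_gain_pos_iff (π : OptProblem) (C : Config) (x' : Fin C.n → List Bool) :
    0 < ∑ v, gain π C x' v ↔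
      ¬ (if π.maximize then objVal π (sameGraphCfg C x') ≤ objVal π C
        else objVal π C ≤ objVal π (sameGraphCfg C x')) := by
  have h : objVal π (sameGraphCfg C x') = ∑ v : Fin C.n, π.w (sameGraphCfg C x') v := rfl
  have h1 := Finset.sum_sub_distrib (s := Finset.univ)
    (fun v : Fin C.n => π.w (sameGraphCfg C x') v) (fun v => π.w C v)
  have h2 := Finset.sum_sub_distrib (s := Finset.univ)
    (fun v : Fin C.n => π.w C v) (fun v => π.w (sameGraphCfg C x') v)
  rw [h]
  unfold gain objVal
  cases π.maximize <;> simp only [if_true, Bool.false_eq_true, if_false, not_le]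
  · rw [h2, sub_pos]
  · rw [h1, sub_pos]

lemma abs_gain_le (π : OptProblem) (C : Config) (x' : Fin C.n → List Bool) (v : Fin C.n) :
    |gain π C x' v| ≤ 2 * (C.n : ℤ) ^ π.γ := by
  have h1 := abs_le.1 (π.w_bound C v)
  have h2 := abs_le.1 (π.w_bound (sameGraphCfg C x') v)
  have h3 : (sameGraphCfg C x').n = C.n := rfl
  rw [h3] at h2
  unfold gain
  rw [abs_le]
  split_ifs <;> constructor <;> linarith [h1.1, h1.2, h2.1, h2.2]

section Verifier

variable {α β c c₁ c₂ T : ℕ} {A₁ A₂ : LocalAlg} {π : OptProblem}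

lemma not_mem_optSet_of_nonOptCheck (hT : 1 ≤ T)
    (hA₁ : ∀ C : Config, BoundedInput α C → ∀ ident : Fin C.n → ℕ, IsIdAssignment β C ident →
      (C ∈ π.adm ↔ ∃ ℓ, goodLabel c₁ C ℓ ∧ accepts A₁ C ident (oneLabel C ℓ)))
    (hA₂ : ∀ C : Config, BoundedInput α C → ∀ ident : Fin C.n → ℕ, IsIdAssignment β C ident →
      (C ∈ {C : Config | BoundedInput α C} \ π.adm ↔
        ∃ ℓ, goodLabel c₂ C ℓ ∧ accepts A₂ C ident (oneLabel C ℓ)))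
    {C : Config} (hC : BoundedInput α C) {ident : Fin C.n → ℕ} (hid : IsIdAssignment β C ident)
    {ℓ : Fin C.n → List Bool} (hℓ : goodLabel c C ℓ)
    (h : ∀ v, NonOptCheck α c c₁ c₂ T A₁ A₂ π C ident ℓ v) : C ∉ optSet α π := by
  classical
  have hlog : ∀ v, (ℓ v).length / c ≤ Nat.log 2 C.n := fun v => Nat.div_le_of_le_mul (hℓ v)
  have hflag := forall_iff_of_connected C.conn (p := fun u => field 0 (ℓ u) = [])
    fun v u hvu => (h v).1 ⟨u, mem_ball_of_adj hT hvu.symm⟩ (by simpa using hvu)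
  let v₀ : Fin C.n := ⟨0, C.npos⟩
  rintro ⟨hadm, hopt⟩
  by_cases h0 : field 0 (ℓ v₀) = []
  · have h0 : ∀ v, field 0 (ℓ v) = [] := fun v => (hflag v₀ v).2 h0
    refine ((hA₂ C hC ident hid).2 ⟨fun u => field 2 (ℓ u), fun v => ?_, fun v => ?_⟩).2 hadm
    · exact ((h v).2.1 (h0 v)).1.trans (Nat.mul_le_mul_left _ (hlog v))
    · exact ((h v).2.1 (h0 v)).2
  · have h0 : ∀ v, field 0 (ℓ v) ≠ [] := fun v => (not_congr (hflag v₀ v)).2 h0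
    have hx : BoundedInput α (storedInput C ℓ) := fun v =>
      ((h v).2.2 (h0 v)).1.trans (Nat.mul_le_mul_left _ (hlog v))
    have hadm' : storedInput C ℓ ∈ π.adm := by
      refine (hA₁ (storedInput C ℓ) hx ident hid).2
        ⟨fun u => field 2 (ℓ u), fun v => ?_, fun v => ?_⟩
      · exact ((h v).2.2 (h0 v)).2.1.trans (Nat.mul_le_mul_left _ (hlog v))
      · exact ((h v).2.2 (h0 v)).2.2.1
    have : Nonempty (Fin C.n) := ⟨v₀⟩
    refine (sum_gain_pos_iff π C _).1 ?_ (hopt _ hx hadm')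
    refine sum_pos_of_treeCheck C.G ident hid.1 ℓ _ fun v => ?_
    have := ((h v).2.2 (h0 v)).2.2.2
    rwa [treeCheck_induce C.G (ball C v T) v (self_mem_ball C v T)
      (fun u hu => mem_ball_of_adj hT hu) ident ℓ] at this

/-- Honest labels can store a rooted tree together with partial sums of a positive total. -/
lemma exists_tree_data (C : Config) {ident : Fin C.n → ℕ} (f : Fin C.n → ℤ) (M : ℕ)
    (hf : ∀ v, |f v| ≤ M) (hpos : 0 < ∑ v, f v) :
    ∃ (d : Fin C.n → ℕ) (p : Fin C.n → ℕ) (s : Fin C.n → ℤ),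
      (∀ v, d v < C.n) ∧ (∀ v, ∃ u, p v = ident u) ∧ (∀ v, |s v| ≤ C.n * (C.n * M)) ∧
      ∀ ℓ : Fin C.n → List Bool, Function.Injective ident → (∀ v, labelDepth (ℓ v) = d v) →
        (∀ v, labelParent (ℓ v) = p v) → (∀ v, labelSum (ℓ v) = s v) →
        ∀ v, TreeCheck C.G v ident ℓ (f v) := by
  classical
  let r : Fin C.n := ⟨0, C.npos⟩
  have hpar : ∀ v, ∃ u, C.G.dist r v ≠ 0 → C.G.Adj u v ∧ C.G.dist r u + 1 = C.G.dist r v := by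
    intro v
    by_cases hv : C.G.dist r v = 0
    · exact ⟨v, fun h => absurd hv h⟩
    · obtain ⟨u, hu⟩ := C.conn.exists_adj_dist_add_one hv
      exact ⟨u, fun _ => hu⟩
  choose par hpar using hpar
  obtain ⟨s, hs, hsb⟩ := exists_subtree_sums (fun v => C.G.dist r v) par
    (fun v hv => (hpar v hv).2) f
  have hd : ∀ v, C.G.dist r v < C.n := fun v => by
    obtain ⟨p, hp, hl⟩ := C.conn.exists_path_of_dist r v
    simpa [hl] using hp.length_lt
  have hroot : 0 < s r := by
    rw [← sum_roots_eq (fun v => C.G.dist r v) par f s hs] at hpos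
    have h0 : ∀ v, (C.G.dist r v = 0 ↔ r = v) := fun v => C.conn.dist_eq_zero_iff
    simpa [h0] using hpos
  refine ⟨fun v => C.G.dist r v, fun v => ident (par v), s, hd, fun v => ⟨_, rfl⟩, fun v => ?_, ?_⟩
  · refine (hsb v).trans ?_
    calc ∑ u, ((C.G.dist r u : ℤ) + 1) * |f u| ≤ ∑ _u : Fin C.n, (C.n : ℤ) * M := by
          refine Finset.sum_le_sum fun u _ => ?_
          have := hd u
          exact mul_le_mul (by omega) (hf u) (abs_nonneg _) (by omega)
      _ = C.n * (C.n * M) := by simp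
  · intro ℓ hid h1 h2 h3 v
    unfold TreeCheck
    simp only [h1, h2, h3]
    refine ⟨fun hv => ?_, fun hv => ⟨par v, (hpar v hv).1, rfl, (hpar v hv).2⟩, ?_⟩
    · rwa [← C.conn.dist_eq_zero_iff.1 hv]
    · rw [hs v]
      congr 1
      refine Finset.sum_congr rfl fun u _ => ?_
      by_cases hu : C.G.dist r u ≠ 0 ∧ par u = v
      · rw [if_pos hu, if_pos ⟨hu.2 ▸ (hpar u hu.1).1.symm, hu.1, congrArg ident hu.2⟩]
      · rw [if_neg hu, if_neg fun h => hu ⟨h.2.1, hid h.2.2⟩]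

lemma lt_two_pow_two_mul_log {n : ℕ} (hn : 2 ≤ n) : n < 2 ^ (2 * Nat.log 2 n) := by
  have h1 : 1 ≤ Nat.log 2 n := Nat.log_pos (by norm_num) hn
  exact (Nat.lt_pow_succ_log_self (by norm_num) n).trans_le
    (Nat.pow_le_pow_right (by norm_num) (by omega))

lemma exists_nonOptCheck {a : ℕ} (ha : a = α + c₁ + c₂ + 2 * β + 2 * π.γ + 6)
    (hc : c = 7 * (2 * a + 1)) (hT : 1 ≤ T)
    (hA₁ : ∀ C : Config, BoundedInput α C → ∀ ident : Fin C.n → ℕ, IsIdAssignment β C ident →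
      (C ∈ π.adm ↔ ∃ ℓ, goodLabel c₁ C ℓ ∧ accepts A₁ C ident (oneLabel C ℓ)))
    (hA₂ : ∀ C : Config, BoundedInput α C → ∀ ident : Fin C.n → ℕ, IsIdAssignment β C ident →
      (C ∈ {C : Config | BoundedInput α C} \ π.adm ↔
        ∃ ℓ, goodLabel c₂ C ℓ ∧ accepts A₂ C ident (oneLabel C ℓ)))
    {C : Config} (hC : BoundedInput α C) (hn : 2 ≤ C.n) {ident : Fin C.n → ℕ}
    (hid : IsIdAssignment β C ident) (hopt : C ∉ optSet α π) :
    ∃ ℓ, goodLabel c C ℓ ∧ ∀ v, NonOptCheck α c c₁ c₂ T A₁ A₂ π C ident ℓ v := by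
  classical
  have hk : 1 ≤ Nat.log 2 C.n := Nat.log_pos (by norm_num) hn
  have hn2 := lt_two_pow_two_mul_log hn
  set k := Nat.log 2 C.n with hkdef
  have hck : c * k / c = k := Nat.mul_div_cancel_left _ (by omega)
  have hbits : ∀ {m e b : ℕ}, m < 2 ^ (e * k + b) → e + b ≤ a → m.bits.length ≤ a * k := by
    intro m e b h he
    refine (length_bits_le h).trans ?_
    nlinarith
  have hle : ∀ {e : ℕ} {l : List Bool}, l.length ≤ e * k → e ≤ a → l.length ≤ a * k :=
    fun h he => h.trans (Nat.mul_le_mul_right _ he)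
  by_cases hadm : C ∈ π.adm
  · have : ∃ x' : Fin C.n → List Bool, BoundedInput α (sameGraphCfg C x') ∧
        sameGraphCfg C x' ∈ π.adm ∧ 0 < ∑ v, gain π C x' v := by
      by_contra hcon
      refine hopt ⟨hadm, fun x' hx hx' => ?_⟩
      by_contra hlt
      exact hcon ⟨x', hx, hx', (sum_gain_pos_iff π C x').2 hlt⟩
    obtain ⟨x', hx', hadm', hpos⟩ := this
    obtain ⟨cert, hcert, hacc⟩ := (hA₁ _ hx' ident hid).1 hadm'
    obtain ⟨d, p, s, hd, hp, hs, htree⟩ := exists_tree_data C (ident := ident) _ (2 * C.n ^ π.γ)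
      (fun v => by exact_mod_cast abs_gain_le π C x' v) hpos
    have hsb : ∀ v, (s v).natAbs < 2 ^ ((2 * π.γ + 4) * k + 1) := by
      intro v
      have h1 : (s v).natAbs ≤ C.n * (C.n * (2 * C.n ^ π.γ)) := by
        have := hs v
        zify
        exact_mod_cast this
      have h2 : C.n * (C.n * (2 * C.n ^ π.γ)) = C.n ^ (π.γ + 2) * 2 := by ring
      have h3 : (2 : ℕ) ^ ((2 * π.γ + 4) * k + 1) = (2 ^ (2 * k)) ^ (π.γ + 2) * 2 := by
        rw [← pow_mul, ← pow_succ]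
        congr 1
        ring
      rw [h3]
      have h4 := Nat.pow_lt_pow_left hn2 (n := π.γ + 2) (by omega)
      omega
    have hpb : ∀ v, p v < 2 ^ (2 * β * k + 1) := by
      intro v
      obtain ⟨u, hu⟩ := hp v
      have h1 := (hid.2 u).2
      have h2 := Nat.pow_le_pow_left hn2.le β
      rw [← pow_mul] at h2
      have h3 : 2 * β * k = 2 * k * β := by ring
      rw [hu, h3, pow_succ]
      have : 0 < 2 ^ (2 * k * β) := by positivity
      omega
    have hlab : ∀ v, ∃ l : List Bool, l.length = c * k ∧ field 0 l = [true] ∧ field 1 l = x' v ∧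
        field 2 l = cert v ∧ labelDepth l = d v ∧ labelParent l = p v ∧ labelSum l = s v := by
      intro v
      obtain ⟨l, hl, hfld⟩ := exists_field_eq_of_length a k hk
        [[true], x' v, cert v, (d v).bits, (p v).bits, (s v).toNat.bits, (-s v).toNat.bits] (by
          simp only [List.mem_cons, List.not_mem_nil, or_false, forall_eq_or_imp, forall_eq]
          refine ⟨?_, hle (hx' v) (by omega), hle (hcert v) (by omega),
            hbits (e := 2) (b := 0) ((hd v).trans hn2) (by omega),
            hbits (hpb v) (by omega), hbits (lt_of_le_of_lt ?_ (hsb v)) (by omega),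
            hbits (lt_of_le_of_lt ?_ (hsb v)) (by omega)⟩
          · simp only [List.length_singleton]
            nlinarith
          · omega
          · omega)
      have hfld' := fun i (h : i < 7) => hfld i h
      refine ⟨l, by rw [hl, hc]; rfl, hfld' 0 (by omega), hfld' 1 (by omega), hfld' 2 (by omega),
        ?_, ?_, ?_⟩
      · rw [labelDepth, hfld' 3 (by omega)]
        exact bitsToNat_bits _
      · rw [labelParent, hfld' 4 (by omega)]
        exact bitsToNat_bits _
      · rw [labelSum, hfld' 5 (by omega), hfld' 6 (by omega)]
        simp only [List.getElem_cons_succ, List.getElem_cons_zero, bitsToNat_bits]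
        omega
    choose ℓ hlen h0 h1 h2 h3 h4 h5 using hlab
    have e1 : (fun u => field 1 (ℓ u)) = x' := funext h1
    have e2 : (fun u => field 2 (ℓ u)) = cert := funext h2
    refine ⟨ℓ, fun v => (hlen v).le, fun v => ⟨fun u _ => by simp [h0], by simp [h0], fun _ => ?_⟩⟩
    unfold storedInput
    rw [e1, e2, hlen, hck, h1, h2]
    refine ⟨hx' v, hcert v, hacc v, ?_⟩
    rw [treeCheck_induce C.G (ball C v T) v (self_mem_ball C v T)
      (fun u hu => mem_ball_of_adj hT hu) ident ℓ]
    exact htree ℓ hid.1 h3 h4 h5 v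
  · obtain ⟨cert, hcert, hacc⟩ := (hA₂ C hC ident hid).1 ⟨hC, hadm⟩
    have hlab : ∀ v, ∃ l : List Bool, l.length = c * k ∧ field 0 l = [] ∧ field 2 l = cert v := by
      intro v
      obtain ⟨l, hl, hfld⟩ := exists_field_eq_of_length a k hk
        [[], [], cert v, [], [], [], []] (by
          simpa using hle (hcert v) (by omega))
      have hfld' := fun i (h : i < 7) => hfld i h
      exact ⟨l, by rw [hl, hc]; rfl, hfld' 0 (by omega), hfld' 2 (by omega)⟩
    choose ℓ hlen h0 h2 using hlab
    have e2 : (fun u => field 2 (ℓ u)) = cert := funext h2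
    refine ⟨ℓ, fun v => (hlen v).le, fun v => ⟨fun u _ => by simp [h0], fun _ => ?_, by simp [h0]⟩⟩
    rw [e2, hlen, hck, h2]
    exact ⟨hcert v, hacc v⟩

end Verifier

/-- If `adm_π ∈ Λ_1 ∩ co-Λ_1` then `opt_π ∈ co-Λ_1`. -/
theorem opt_in_coLambda1 (α β : ℕ) (hα : 1 ≤ α) (hβ : 1 ≤ β) (π : OptProblem)
    (hadm : IsDistLang α π.adm)
    (ha1 : LambdaC α β 1 π.adm) (ha2 : coLambdaC α β 1 π.adm) :
    coLambdaC α β 1 (optSet α π) := by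
  classical
  rw [lambdaC_one_iff] at ha1
  rw [coLambdaC, lambdaC_one_iff] at ha2 ⊢
  obtain ⟨A₁, c₁, hA₁⟩ := ha1
  obtain ⟨A₂, c₂, hA₂⟩ := ha2
  obtain ⟨a, ha⟩ : ∃ a, a = α + c₁ + c₂ + 2 * β + 2 * π.γ + 6 := ⟨_, rfl⟩
  obtain ⟨c, hc⟩ : ∃ c, c = 7 * (2 * a + 1) := ⟨_, rfl⟩
  refine ⟨nonOptAlg α c c₁ c₂ A₁ A₂ π
    (decide (∃ C, BoundedInput α C ∧ C.n = 1 ∧ C ∉ optSet α π)), c, fun C hC ident hid => ?_⟩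
  have hT : 1 ≤ A₁.t + A₂.t + π.r + 1 := by omega
  by_cases hn : C.n = 1
  · have hsub := fun v => (subsingleton_ball_iff C v hT).2 hn
    have hacc : ∀ ℓ, accepts (nonOptAlg α c c₁ c₂ A₁ A₂ π
        (decide (∃ C, BoundedInput α C ∧ C.n = 1 ∧ C ∉ optSet α π))) C ident (oneLabel C ℓ) ↔
        C ∉ optSet α π := by
      intro ℓ
      simp only [accepts, nonOptAlg, hsub, if_true, decide_eq_true_eq]
      refine ⟨fun h => ?_, fun h v => ⟨C, hC, hn, h⟩⟩
      obtain ⟨C', hC', hn', h'⟩ := h ⟨0, C.npos⟩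
      rwa [eq_of_n_eq_one hC hC' hn hn']
    simp only [hacc]
    exact ⟨fun h => ⟨fun _ => [], fun _ => by simp, h.2⟩, fun ⟨_, _, h⟩ => ⟨hC, h⟩⟩
  · have hacc : ∀ ℓ, accepts (nonOptAlg α c c₁ c₂ A₁ A₂ π
        (decide (∃ C, BoundedInput α C ∧ C.n = 1 ∧ C ∉ optSet α π))) C ident (oneLabel C ℓ) ↔
        ∀ v, NonOptCheck α c c₁ c₂ (A₁.t + A₂.t + π.r + 1) A₁ A₂ π C ident ℓ v := by
      intro ℓ
      simp only [accepts, nonOptAlg, subsingleton_ball_iff C _ hT, hn, if_false,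
        decide_eq_true_eq, oneLabel, Function.update_self]
    simp only [hacc]
    constructor
    · rintro ⟨_, h⟩
      exact exists_nonOptCheck ha hc hT hA₁ hA₂ hC (by have := C.npos; omega) hid h
    · rintro ⟨ℓ, hℓ, h⟩
      exact ⟨hC, not_mem_optSet_of_nonOptCheck hT hA₁ hA₂ hC hid hℓ h⟩
end

section
/- The distributed language MAX-INDEPENDENT-SET, consisting of all configurations (G,x) with x(v) ∈ {0,1} for every node v such that the set {v : x(v) = 1} is an independent set of G of maximum cardinality among all independent sets of G, is in co-Λ_1. -/
/-- `MAX-INDEPENDENT-SET`: each node's input is a single bit, the nodes with input 1 form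
an independent set of `G`, of maximum cardinality among all independent sets of `G`. -/
def MaxIndepLang : Set Config :=
  {C | (∀ v, C.x v = [true] ∨ C.x v = [false]) ∧
       (∀ u v : Fin C.n, C.x u = [true] → C.x v = [true] → ¬ C.G.Adj u v) ∧
       (∀ S : Set (Fin C.n), (∀ u ∈ S, ∀ v ∈ S, ¬ C.G.Adj u v) →
          S.ncard ≤ {v : Fin C.n | C.x v = [true]}.ncard)}

/-- What a node can see of a single node in its neighbourhood. -/
structure NodeView where
  input : List Bool
  ident : ℕ
  label : List Bool

/-- The view of the node `v`, the label being the first labelling. -/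
def nodeView (C : Config) (ident : Fin C.n → ℕ) (ℓs : ℕ → Fin C.n → List Bool)
    (v : Fin C.n) : NodeView :=
  ⟨C.x v, ident v, ℓs 0 v⟩

open Classical in
/-- The multiset of views of the neighbours of `v`. -/
noncomputable def neighborViews (C : Config) (ident : Fin C.n → ℕ)
    (ℓs : ℕ → Fin C.n → List Bool) (v : Fin C.n) : Multiset NodeView :=
  (Finset.univ.filter fun u => C.G.Adj v u).val.map (nodeView C ident ℓs)

lemma mem_ball_one_of_adj {C : Config} {v u : Fin C.n} (h : C.G.Adj v u) : u ∈ ball C v 1 :=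
  (SimpleGraph.dist_eq_one_iff_adj.2 h).le

open Classical in
/-- The one-round algorithm deciding a predicate of a node's view and the multiset of the
views of its neighbours. -/
noncomputable def oneRoundAlg (P : NodeView → Multiset NodeView → Prop) : LocalAlg where
  t := 1
  run C ident ℓs v := decide (P (nodeView C ident ℓs v) (neighborViews C ident ℓs v))
  isLocal := by
    intro C C' ident ident' ℓ ℓ' v v' φ hv hx hid hℓ
    have hview : ∀ u : ball C v 1, nodeView C ident ℓ u.1 = nodeView C' ident' ℓ' (φ u).1 := by
      intro u
      simp only [nodeView, hx, hid, hℓ]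
    have hcenter : nodeView C ident ℓ v = nodeView C' ident' ℓ' v' := by
      rw [← hv, ← hview]
    have hnbrs : neighborViews C ident ℓ v = neighborViews C' ident' ℓ' v' := by
      refine Multiset.map_eq_map_of_bij_of_nodup _ _ (Finset.nodup _) (Finset.nodup _)
        (fun u hu => (φ ⟨u, mem_ball_one_of_adj (by simpa using hu)⟩).1) ?_ ?_ ?_ ?_
      · intro u hu
        have hadj : C.G.Adj v u := by simpa using hu
        have hφ : (C.G.induce (ball C v 1)).Adj ⟨v, self_mem_ball C v 1⟩
            ⟨u, mem_ball_one_of_adj hadj⟩ := hadj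
        have h := φ.map_rel_iff.2 hφ
        rw [SimpleGraph.comap_adj] at h
        simpa [← hv] using h
      · intro u hu w hw huw
        simpa using φ.injective (Subtype.ext huw)
      · intro u' hu'
        have hadj' : C'.G.Adj v' u' := by simpa using hu'
        obtain ⟨⟨u, hu⟩, hφu⟩ := φ.surjective ⟨u', mem_ball_one_of_adj hadj'⟩
        have h : (C'.G.induce (ball C' v' 1)).Adj (φ ⟨v, self_mem_ball C v 1⟩) (φ ⟨u, hu⟩) := by
          rw [hφu, SimpleGraph.comap_adj]
          simpa [hv] using hadj'
        have hadj : C.G.Adj v u := φ.map_rel_iff.1 h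
        exact ⟨u, by simpa using hadj, congrArg Subtype.val hφu⟩
      · intro u hu
        exact hview ⟨u, _⟩
    rw [hcenter, hnbrs]

lemma accepts_oneRoundAlg (P : NodeView → Multiset NodeView → Prop) (C : Config)
    (ident : Fin C.n → ℕ) (ℓs : ℕ → Fin C.n → List Bool) :
    accepts (oneRoundAlg P) C ident ℓs ↔
      ∀ v, P (nodeView C ident ℓs v) (neighborViews C ident ℓs v) := by
  simp [accepts, oneRoundAlg]

/-- A certificate: the identity of the parent in a rooted spanning tree (`0` at the root),
a membership bit for a competing independent set, and the numbers of members of the competing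
set and of the input set in the subtree of the node. -/
structure Cert where
  parent : ℕ
  member : ℕ
  competing : ℕ
  given : ℕ

instance : Inhabited Cert := ⟨⟨0, 0, 0, 0⟩⟩

/-- Certificates as bit strings. -/
def Cert.encode (c : Cert) : List Bool :=
  (Nat.pair (Nat.pair c.parent c.member) (Nat.pair c.competing c.given)).bits

lemma Nat.bits_injective : Function.Injective Nat.bits := by
  intro a b h
  apply Nat.digits.injective 2
  rw [Nat.digits_two_eq_bits, Nat.digits_two_eq_bits, h]

lemma Cert.encode_injective : Function.Injective Cert.encode := by
  rintro ⟨p, m, a, b⟩ ⟨p', m', a', b'⟩ h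
  have h := Nat.bits_injective h
  simp only [Nat.pair_eq_pair] at h
  simp [h]

lemma Nat.pair_lt_two_pow {a b k : ℕ} (ha : a < 2 ^ k) (hb : b < 2 ^ k) :
    Nat.pair a b < 2 ^ (2 * k) := by
  refine (Nat.pair_lt_max_add_one_sq a b).trans_le ?_
  rw [mul_comm, pow_mul]
  exact Nat.pow_le_pow_left (max_lt ha hb) 2

lemma Cert.length_encode_le {c : Cert} {k : ℕ} (hp : c.parent < 2 ^ k) (hm : c.member < 2 ^ k)
    (ha : c.competing < 2 ^ k) (hb : c.given < 2 ^ k) : c.encode.length ≤ 4 * k := by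
  rw [Cert.encode, Nat.size_eq_bits_len, Nat.size_le]
  have h := Nat.pair_lt_two_pow (Nat.pair_lt_two_pow hp hm) (Nat.pair_lt_two_pow ha hb)
  rwa [show 2 * (2 * k) = 4 * k by ring] at h

/-- The certificate encoded by a bit string. -/
noncomputable def Cert.decode : List Bool → Cert := Function.invFun Cert.encode

lemma Cert.decode_encode (c : Cert) : Cert.decode c.encode = c :=
  Function.leftInverse_invFun Cert.encode_injective c

open Classical in
/-- The sum of `f` over the neighbours of a node whose parent is that node. -/
noncomputable def childSum {V : Type*} [Fintype V] (G : SimpleGraph V) (ident p f : V → ℕ)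
    (v : V) : ℕ :=
  ∑ u with G.Adj v u, if p u = ident v then f u else 0

section ChildSum

variable {V : Type*} [Fintype V] {G : SimpleGraph V} {ident p f g : V → ℕ}

lemma sum_childSum (hinj : Function.Injective ident) (hpos : ∀ v, 1 ≤ ident v)
    (hp : ∀ v, p v = 0 ∨ ∃ u, G.Adj v u ∧ ident u = p v) :
    ∑ v, childSum G ident p f v = ∑ v with ¬ p v = 0, f v := by
  classical
  simp only [childSum, Finset.sum_filter]
  rw [Finset.sum_comm]
  refine Finset.sum_congr rfl fun u _ => ?_
  by_cases h0 : p u = 0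
  · rw [if_neg (by simpa using h0)]
    refine Finset.sum_eq_zero fun v _ => ?_
    have := hpos v
    rw [if_neg (by omega : ¬ p u = ident v), ite_self]
  · obtain ⟨w, hadj, hw⟩ := (hp u).resolve_left h0
    rw [if_pos h0, Finset.sum_eq_single w]
    · rw [if_pos hadj.symm, if_pos hw.symm]
    · intro v _ hv
      have hne : ¬ p u = ident v := fun h' => hv (hinj (h'.symm.trans hw.symm))
      rw [if_neg hne, ite_self]
    · simp

/-- Subtree sums at the roots add up to the total weight. -/
lemma sum_roots_eq_s13 (hinj : Function.Injective ident) (hpos : ∀ v, 1 ≤ ident v)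
    (hp : ∀ v, p v = 0 ∨ ∃ u, G.Adj v u ∧ ident u = p v)
    (hf : ∀ v, f v = g v + childSum G ident p f v) :
    ∑ v with p v = 0, f v = ∑ v, g v := by
  have h1 : ∑ v, f v = ∑ v, g v + ∑ v with ¬ p v = 0, f v := by
    rw [← sum_childSum hinj hpos hp, ← Finset.sum_add_distrib]
    exact Finset.sum_congr rfl fun v _ => hf v
  have h2 := Finset.sum_filter_add_sum_filter_not Finset.univ (fun v => p v = 0) f
  omega

lemma le_of_child (hf : ∀ v, f v = g v + childSum G ident p f v) {u v : V}
    (hadj : G.Adj v u) (hu : p u = ident v) : f u ≤ f v := by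
  classical
  rw [hf v]
  refine le_add_left ?_
  have h := Finset.single_le_sum (f := fun u => if p u = ident v then f u else 0)
    (s := Finset.univ.filter fun u => G.Adj v u) (fun _ _ => Nat.zero_le _) (by simpa using hadj)
  rw [if_pos hu] at h
  convert h using 1
  rfl

/-- Subtree sums exist when the depth increases by one from a node to its children. -/
lemma exists_subtreeSum (g : V → ℕ) (d : V → ℕ)
    (hd : ∀ v u, G.Adj v u → p u = ident v → d u = d v + 1) :
    ∃ f : V → ℕ, ∀ v, f v = g v + childSum G ident p f v := by
  classical
  obtain ⟨N, hN⟩ : ∃ N, ∀ v, d v < N :=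
    ⟨Finset.univ.sup d + 1, fun v => Nat.lt_succ_of_le (Finset.le_sup (Finset.mem_univ v))⟩
  let F : ℕ → V → ℕ := fun k =>
    Nat.rec (fun _ => 0) (fun _ f v => g v + childSum G ident p f v) k
  refine ⟨fun v => F (N - d v) v, fun v => ?_⟩
  have hv := hN v
  obtain ⟨k, hk⟩ : ∃ k, N - d v = k + 1 := ⟨N - d v - 1, by omega⟩
  simp only [hk]
  change g v + childSum G ident p (F k) v = _
  congr 1
  refine Finset.sum_congr rfl fun u hu => ?_
  split_ifs with h
  · have := hd v u (by simpa using hu) h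
    simp only [show N - d u = k by omega]
  · rfl

/-- A connected graph has a rooted spanning tree with subtree sums for any two weights. -/
lemma exists_parent (hG : G.Connected) (hinj : Function.Injective ident)
    (hpos : ∀ v, 1 ≤ ident v) (r : V) :
    ∃ p : V → ℕ, (∀ v, p v = 0 ↔ v = r) ∧
      (∀ v, p v = 0 ∨ ∃ u, G.Adj v u ∧ ident u = p v) ∧
      ∀ g : V → ℕ, ∃ f : V → ℕ, (∀ v, f v = g v + childSum G ident p f v) ∧
        f r = ∑ v, g v ∧ ∀ v, f v ≤ ∑ v, g v := by
  classical
  have hstep : ∀ v, v ≠ r → ∃ u, G.Adj v u ∧ G.dist v r = G.dist u r + 1 := by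
    intro v hv
    obtain ⟨w, hw⟩ := hG.exists_walk_length_eq_dist v r
    cases w with
    | nil => exact absurd rfl hv
    | @cons _ u _ hadj q =>
      refine ⟨u, hadj, ?_⟩
      have h1 := SimpleGraph.dist_le q
      have h2 := hG.dist_triangle (u := v) (v := u) (w := r)
      rw [SimpleGraph.dist_eq_one_iff_adj.2 hadj] at h2
      rw [SimpleGraph.Walk.length_cons] at hw
      omega
  choose! par hpar using hstep
  have hroot : ∀ v, (if v = r then 0 else ident (par v)) = 0 ↔ v = r := by
    intro v
    have := hpos (par v)
    split_ifs with h <;> simp [h]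
    omega
  have hparent : ∀ v, (if v = r then 0 else ident (par v)) = 0 ∨
      ∃ u, G.Adj v u ∧ ident u = if v = r then 0 else ident (par v) := by
    intro v
    by_cases h : v = r
    · simp [h]
    · exact Or.inr ⟨par v, (hpar v h).1, by simp [h]⟩
  refine ⟨fun v => if v = r then 0 else ident (par v), hroot, hparent, fun g => ?_⟩
  obtain ⟨f, hf⟩ := exists_subtreeSum (G := G) (ident := ident)
    (p := fun v => if v = r then 0 else ident (par v)) g (fun v => G.dist v r) (by
      intro v u _ hu
      have := hpos v
      by_cases h : u = r
      · simp only [h, if_true] at hu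
        omega
      · simp only [h, if_false] at hu
        rw [(hpar u h).2, hinj hu])
  have hfr : f r = ∑ v, g v := by
    rw [← sum_roots_eq_s13 hinj hpos hparent hf]
    simp [hroot, Finset.sum_filter]
  refine ⟨f, hf, hfr, ?_⟩
  have hle : ∀ k v, G.dist v r = k → f v ≤ f r := by
    intro k
    induction k with
    | zero =>
      intro v hv
      rw [hG.dist_eq_zero_iff.1 hv]
    | succ k ih =>
      intro v hv
      have hne : v ≠ r := by
        rintro rfl
        simp at hv
      have h := hpar v hne
      exact (le_of_child hf h.1.symm (by simp [hne])).trans (ih _ (by omega))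
  exact fun v => hfr ▸ hle _ v rfl

end ChildSum

/-- The local check of the certificates for the complement of `MAX-INDEPENDENT-SET`. -/
def CertCheck (own : NodeView) (nbrs : Multiset NodeView) : Prop :=
  let c := Cert.decode own.label
  c.competing = (if c.member = 1 then 1 else 0) + (nbrs.map fun u =>
    if (Cert.decode u.label).parent = own.ident then (Cert.decode u.label).competing else 0).sum ∧
  c.given = (if own.input = [true] then 1 else 0) + (nbrs.map fun u =>
    if (Cert.decode u.label).parent = own.ident then (Cert.decode u.label).given else 0).sum ∧
  (c.member = 1 → ∀ u ∈ nbrs, (Cert.decode u.label).member ≠ 1) ∧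
  (c.parent = 0 ∨ ∃ u ∈ nbrs, u.ident = c.parent) ∧
  (c.parent = 0 → c.given < c.competing ∨ ¬ (own.input = [true] ∨ own.input = [false]) ∨
    (own.input = [true] ∧ ∃ u ∈ nbrs, u.input = [true]))

/-- The certificate check at `v`, phrased in terms of the graph. -/
lemma certCheck_iff (C : Config) (ident : Fin C.n → ℕ) (ℓs : ℕ → Fin C.n → List Bool)
    (c : Fin C.n → Cert) (hc : ∀ v, Cert.decode (ℓs 0 v) = c v) (v : Fin C.n) :
    CertCheck (nodeView C ident ℓs v) (neighborViews C ident ℓs v) ↔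
      (c v).competing = (if (c v).member = 1 then 1 else 0) +
        childSum C.G ident (fun u => (c u).parent) (fun u => (c u).competing) v ∧
      (c v).given = (if C.x v = [true] then 1 else 0) +
        childSum C.G ident (fun u => (c u).parent) (fun u => (c u).given) v ∧
      ((c v).member = 1 → ∀ u, C.G.Adj v u → (c u).member ≠ 1) ∧
      ((c v).parent = 0 ∨ ∃ u, C.G.Adj v u ∧ ident u = (c v).parent) ∧
      ((c v).parent = 0 → (c v).given < (c v).competing ∨
        ¬ (C.x v = [true] ∨ C.x v = [false]) ∨
        (C.x v = [true] ∧ ∃ u, C.G.Adj v u ∧ C.x u = [true])) := by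
  simp [CertCheck, neighborViews, nodeView, childSum, hc, Multiset.map_map, Finset.sum]
  intros
  rfl

/-- Accepted certificates rule out `MAX-INDEPENDENT-SET`. -/
lemma notMem_maxIndepLang_of_certCheck {β : ℕ} {C : Config} {ident : Fin C.n → ℕ}
    (hid : IsIdAssignment β C ident) {ℓs : ℕ → Fin C.n → List Bool}
    (h : ∀ v, CertCheck (nodeView C ident ℓs v) (neighborViews C ident ℓs v)) :
    C ∉ MaxIndepLang := by
  classical
  rintro ⟨hbit, hind, hmax⟩
  simp only [certCheck_iff C ident ℓs (fun v => Cert.decode (ℓs 0 v)) (fun _ => rfl)] at h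
  set c : Fin C.n → Cert := fun v => Cert.decode (ℓs 0 v)
  have hpos : ∀ v, 1 ≤ ident v := fun v => (hid.2 v).1
  have hS := sum_roots_eq_s13 hid.1 hpos (fun v => (h v).2.2.2.1) (fun v => (h v).1)
  have hX := sum_roots_eq_s13 hid.1 hpos (fun v => (h v).2.2.2.1) (fun v => (h v).2.1)
  rw [← Finset.card_filter] at hS hX
  have hroot : ∀ v, (c v).parent = 0 → (c v).given < (c v).competing := by
    intro v hv
    rcases (h v).2.2.2.2 hv with hlt | hx | ⟨hx, u, hadj, hu⟩
    · exact hlt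
    · exact absurd (hbit v) hx
    · exact absurd hadj (hind v u hx hu)
  have hXcard : {v : Fin C.n | C.x v = [true]}.ncard =
      (Finset.univ.filter fun v => C.x v = [true]).card := by
    rw [← Set.ncard_coe_finset]
    simp
  have hScard := hmax ↑(Finset.univ.filter fun v => (c v).member = 1) (by
    intro u hu v hv hadj
    simp only [Finset.coe_filter, Finset.mem_univ, true_and, Set.mem_ofPred_eq] at hu hv
    exact (h u).2.2.1 hu v hadj hv)
  rw [Set.ncard_coe_finset, hXcard, ← hS, ← hX] at hScard
  by_cases hne : (Finset.univ.filter fun v => (c v).parent = 0).Nonempty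
  · exact hScard.not_gt (Finset.sum_lt_sum_of_nonempty hne fun v hv =>
      hroot v (Finset.mem_filter.1 hv).2)
  · rw [Finset.not_nonempty_iff_eq_empty] at hne
    have hsingle := hmax {⟨0, C.npos⟩} (by simp)
    rw [Set.ncard_singleton, hXcard, ← hX, hne] at hsingle
    simp at hsingle

/-- Outside `MAX-INDEPENDENT-SET` there is a larger independent set or a local defect; a
one-node graph always has a local defect, as its input is empty. -/
lemma exists_defect {α : ℕ} {C : Config} (hC : BoundedInput α C) (h : C ∉ MaxIndepLang) :
    ∃ (S : Finset (Fin C.n)) (r : Fin C.n), (∀ u ∈ S, ∀ v ∈ S, ¬ C.G.Adj u v) ∧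
      (C.n = 1 → S = ∅) ∧
      ((Finset.univ.filter fun v => C.x v = [true]).card < S.card ∨
        ¬ (C.x r = [true] ∨ C.x r = [false]) ∨
        (C.x r = [true] ∧ ∃ u, C.G.Adj r u ∧ C.x u = [true])) := by
  classical
  by_cases hbit : ∀ v, C.x v = [true] ∨ C.x v = [false]
  · by_cases hind : ∀ u v : Fin C.n, C.x u = [true] → C.x v = [true] → ¬ C.G.Adj u v
    · have hmax : ¬ ∀ S : Set (Fin C.n), (∀ u ∈ S, ∀ v ∈ S, ¬ C.G.Adj u v) →
          S.ncard ≤ {v : Fin C.n | C.x v = [true]}.ncard := fun hmax => h ⟨hbit, hind, hmax⟩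
      push Not at hmax
      obtain ⟨S, hS, hlt⟩ := hmax
      refine ⟨S.toFinset, ⟨0, C.npos⟩, by simpa using hS, fun h1 => ?_, Or.inl ?_⟩
      · have h0 := hC ⟨0, C.npos⟩
        simp only [h1, Nat.log_one_right, mul_zero] at h0
        rcases hbit ⟨0, C.npos⟩ with hx | hx <;> simp [hx] at h0
      · rw [← Set.ncard_eq_toFinset_card', ← Set.ncard_coe_finset]
        simpa using hlt
    · push Not at hind
      obtain ⟨u, v, hu, hv, hadj⟩ := hind
      exact ⟨∅, u, by simp, fun _ => rfl, Or.inr (Or.inr ⟨hu, v, hadj, hv⟩)⟩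
  · push Not at hbit
    obtain ⟨v, hv⟩ := hbit
    exact ⟨∅, v, by simp, fun _ => rfl, Or.inr (Or.inl (by tauto))⟩

lemma pow_lt_two_pow {n β : ℕ} (hn : 2 ≤ n) (hβ : 1 ≤ β) :
    n ^ β < 2 ^ (2 * β * Nat.log 2 n) := by
  have hlog : 1 ≤ Nat.log 2 n := Nat.log_pos (by norm_num) hn
  calc n ^ β < (2 ^ (Nat.log 2 n + 1)) ^ β :=
        Nat.pow_lt_pow_left (Nat.lt_pow_succ_log_self (by norm_num) n) (by omega)
    _ = 2 ^ ((Nat.log 2 n + 1) * β) := (pow_mul _ _ _).symm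
    _ ≤ 2 ^ (2 * β * Nat.log 2 n) := Nat.pow_le_pow_right (by norm_num) (by nlinarith)

/-- Outside `MAX-INDEPENDENT-SET` there are short accepted certificates. -/
lemma exists_certCheck {α β : ℕ} (hβ : 1 ≤ β) {C : Config} (hC : BoundedInput α C)
    {ident : Fin C.n → ℕ} (hid : IsIdAssignment β C ident) (h : C ∉ MaxIndepLang) :
    ∃ ℓ : Fin C.n → List Bool, goodLabel (8 * β) C ℓ ∧ ∀ ℓs : ℕ → Fin C.n → List Bool,
      ℓs 0 = ℓ → ∀ v, CertCheck (nodeView C ident ℓs v) (neighborViews C ident ℓs v) := by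
  classical
  obtain ⟨S, r, hS, hS1, hdef⟩ := exists_defect hC h
  have hpos : ∀ v, 1 ≤ ident v := fun v => (hid.2 v).1
  obtain ⟨p, hroot, hp, hsum⟩ := exists_parent C.conn hid.1 hpos r
  obtain ⟨a, ha, har, hale⟩ := hsum fun v => if v ∈ S then 1 else 0
  obtain ⟨b, hb, hbr, hble⟩ := hsum fun v => if C.x v = [true] then 1 else 0
  rw [← Finset.card_filter] at har hbr
  simp only [← Finset.card_filter] at hale hble
  have hSuniv : (Finset.univ.filter fun v => v ∈ S) = S := by simp
  rw [hSuniv] at har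
  simp only [hSuniv] at hale
  let c : Fin C.n → Cert := fun v => ⟨p v, if v ∈ S then 1 else 0, a v, b v⟩
  have hbound : (∀ v, p v < 2 ^ (2 * β * Nat.log 2 C.n)) ∧
      S.card < 2 ^ (2 * β * Nat.log 2 C.n) ∧
      (Finset.univ.filter fun v => C.x v = [true]).card < 2 ^ (2 * β * Nat.log 2 C.n) := by
    rcases Nat.lt_or_ge C.n 2 with hn | hn
    · have h1 : C.n = 1 := by have := C.npos; omega
      have hsub : Subsingleton (Fin C.n) := by rw [h1]; infer_instance
      have hx : ∀ v, C.x v = [] := by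
        intro v
        have := hC v
        rw [h1] at this
        simpa using this
      refine ⟨fun v => ?_, ?_, ?_⟩
      · rw [(hroot v).2 (Subsingleton.elim _ _)]
        positivity
      · rw [hS1 h1]
        simp
      · simp [hx]
    · have hpow := pow_lt_two_pow hn hβ
      have hcard : ∀ T : Finset (Fin C.n), T.card < 2 ^ (2 * β * Nat.log 2 C.n) := fun T =>
        ((T.card_le_univ.trans_eq (Fintype.card_fin _)).trans
          (Nat.le_self_pow (by omega) _)).trans_lt hpow
      refine ⟨fun v => ?_, hcard _, hcard _⟩
      rcases hp v with h0 | ⟨u, _, hu⟩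
      · rw [h0]
        positivity
      · rw [← hu]
        exact (hid.2 u).2.trans_lt hpow
  refine ⟨fun v => (c v).encode, fun v => ?_, fun ℓs hℓ v => ?_⟩
  · refine (Cert.length_encode_le (hbound.1 v) ?_ ((hale v).trans_lt hbound.2.1)
      ((hble v).trans_lt hbound.2.2)).trans_eq (by ring)
    change (if v ∈ S then 1 else 0) < _
    split_ifs with hv
    · exact lt_of_le_of_lt (Finset.card_pos.2 ⟨v, hv⟩) hbound.2.1
    · positivity
  · rw [certCheck_iff C ident ℓs c (fun u => by rw [hℓ, Cert.decode_encode])]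
    have hmem : ∀ u, (c u).member = 1 ↔ u ∈ S := fun u => by simp [c]
    refine ⟨?_, hb v, ?_, hp v, fun hv => ?_⟩
    · simp only [hmem]
      exact ha v
    · simp only [ne_eq, hmem]
      exact fun hv u hadj hu => hS v hv u hu hadj
    · obtain rfl := (hroot v).1 hv
      refine hdef.imp_left fun hlt => ?_
      change b v < a v
      rwa [har, hbr]

/-- `MAX-INDEPENDENT-SET ∈ co-Λ_1`. -/
theorem maxIndep_in_coLambda1 (α β : ℕ) (hα : 1 ≤ α) (hβ : 1 ≤ β) :
    coLambdaC α β 1 MaxIndepLang := by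
  refine ⟨oneRoundAlg CertCheck, 8 * β, fun C hC ident hid => ?_⟩
  simp only [altQ, accepts_oneRoundAlg]
  constructor
  · rintro ⟨-, h⟩
    obtain ⟨ℓ, hℓ, hcheck⟩ := exists_certCheck hβ hC hid h
    exact ⟨ℓ, hℓ, hcheck _ (Function.update_self ..)⟩
  · rintro ⟨ℓ, -, h⟩
    exact ⟨hC, notMem_maxIndepLang_of_certCheck hid h⟩
end
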